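/- (Roughness of exponential dichotomy, Coppel.) Let A : [0,∞) → Matrix (Fin n) (Fin n) ℝ be continuous with fundamental matrix Φ, and suppose ẋ = A(t)x has an exponential dichotomy on [0,∞) with projection P (P² = P) and constants K ≥ 1, α > 0, i.e., ‖Φ(t)PΦ(s)⁻¹‖ ≤ K e^{-α(t-s)} for t ≥ s ≥ 0 and ‖Φ(t)(I−P)Φ(s)⁻¹‖ ≤ K e^{-α(s-t)} for s ≥ t ≥ 0. Let B : [0,∞) → Matrix (Fin n) (Fin n) ℝ be bounded and continuous with sup_{t ≥ 0} ‖B(t)‖ < α/(4K²). Then the perturbed system ẋ = (A(t)+B(t))x also has an exponential dichotomy on [0,∞): there exist a projection Q with the same null space as P and constants K' ≥ 1, α' > 0 such that the fundamental matrix Ψ of the perturbed system satisfies ‖Ψ(t)QΨ(s)⁻¹‖ ≤ K' e^{-α'(t-s)} for t ≥ s ≥ 0 and ‖Ψ(t)(I−Q)Ψ(s)⁻¹‖ ≤ K' e^{-α'(s-t)} for s ≥ t ≥ 0. -/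

import Mathlib

open Real Set Matrix

attribute [local instance] Matrix.linftyOpNormedRing Matrix.linftyOpNormedSpace

theorem cop_int_left {R : Type*} [NormedRing R] [NormedAlgebra ℝ R]
    (a t γ k : ℝ) (hγ : 0 < γ) (hat : a ≤ t) (hk : 0 ≤ k) (F : ℝ → R)
    (hF : ∀ u ∈ Icc a t, ‖F u‖ ≤ k * exp (-γ * (t - u))) :
    ‖∫ u in a..t, F u‖ ≤ k / γ := by
  have hd : ∀ u ∈ uIcc a t, HasDerivAt (fun u => k / γ * exp (-γ * (t - u)))
      (k * exp (-γ * (t - u))) u := by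
    intro u _
    have h1 : HasDerivAt (fun u => -γ * (t - u)) γ u := by
      have := ((hasDerivAt_id u).const_sub t).const_mul (-γ)
      simpa using this
    have h2 := (h1.exp).const_mul (k / γ)
    refine h2.congr_deriv ?_
    field_simp
  have hI : IntervalIntegrable (fun u => k * exp (-γ * (t - u))) MeasureTheory.volume a t :=
    Continuous.intervalIntegrable (by fun_prop) _ _
  have h := intervalIntegral.integral_eq_sub_of_hasDerivAt hd hI
  have h3 := intervalIntegral.norm_integral_le_of_norm_le (f := F) hat
    (Filter.Eventually.of_forall fun u hu => hF u ⟨hu.1.le, hu.2⟩) hI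
  rw [h] at h3
  have : 0 ≤ k / γ * exp (-γ * (t - a)) := by positivity
  simp at h3
  simp at this
  linarith

theorem cop_int_right {R : Type*} [NormedRing R] [NormedAlgebra ℝ R]
    (t b γ k : ℝ) (hγ : 0 < γ) (hat : t ≤ b) (hk : 0 ≤ k) (F : ℝ → R)
    (hF : ∀ u ∈ Icc t b, ‖F u‖ ≤ k * exp (-γ * (u - t))) :
    ‖∫ u in t..b, F u‖ ≤ k / γ := by
  have h := cop_int_left (-b) (-t) γ k hγ (by linarith) hk (fun u => F (-u)) (by
    intro u hu
    have := hF (-u) ⟨by linarith [hu.2], by linarith [hu.1]⟩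
    refine this.trans (le_of_eq ?_)
    ring_nf)
  rw [intervalIntegral.integral_comp_neg] at h
  simpa using h

/-- Variation of constants. -/
theorem cop_var {R : Type*} [NormedRing R] [NormedAlgebra ℝ R] [CompleteSpace R]
    (A B Φ Φi Ψ : ℝ → R)
    (hΦ : ∀ t, HasDerivAt Φ (A t * Φ t) t)
    (hΨ : ∀ t, HasDerivAt Ψ ((A t + B t) * Ψ t) t)
    (h1 : ∀ t, Φ t * Φi t = 1) (h2 : ∀ t, Φi t * Φ t = 1)
    (hB : ContinuousOn B (Ici 0)) (D C : R) (x y : ℝ) (hx : 0 ≤ x) (hxy : x ≤ y) :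
    ∫ u in x..y, D * Φi u * (B u * (Ψ u * C)) = D * Φi y * (Ψ y * C) - D * Φi x * (Ψ x * C) := by
  have hΦi : ∀ t, HasDerivAt Φi (-(Φi t * A t)) t := by
    intro t
    let U : Rˣ := ⟨Φ t, Φi t, h1 t, h2 t⟩
    have hinv : Φi = fun t => Ring.inverse (Φ t) := by
      funext t
      exact (Ring.inverse_unit (⟨Φ t, Φi t, h1 t, h2 t⟩ : Rˣ)).symm
    have h := (hasFDerivAt_ringInverse (𝕜 := ℝ) U).comp_hasDerivAt t (hΦ t)
    rw [hinv]
    refine h.congr_deriv ?_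
    have : Ring.inverse (Φ t) = Φi t := (Ring.inverse_unit U)
    simp only [this]
    change -(Φi t * (A t * Φ t) * Φi t) = _
    rw [← mul_assoc, mul_assoc, h1, mul_one]
  have hΦic : Continuous Φi := continuous_iff_continuousAt.2 fun t => (hΦi t).continuousAt
  have hΨc : Continuous Ψ := continuous_iff_continuousAt.2 fun t => (hΨ t).continuousAt
  apply intervalIntegral.integral_eq_sub_of_hasDerivAt (f := fun u => D * Φi u * (Ψ u * C))
  · intro u _
    refine ((((hΦi u).const_mul D)).mul ((hΨ u).mul_const C)).congr_deriv ?_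
    noncomm_ring
  · apply ContinuousOn.intervalIntegrable
    rw [uIcc_of_le hxy]
    have hB' : ContinuousOn B (Icc x y) := hB.mono fun u hu => hx.trans hu.1
    exact (continuousOn_const.mul hΦic.continuousOn).mul
      (hB'.mul (hΨc.continuousOn.mul continuousOn_const))

/-- All the standing data, as one proposition. -/
structure CopData {R : Type*} [NormedRing R] [NormedAlgebra ℝ R]
    (A B Φ Φi Ψ : ℝ → R) (P : R) (K α δ : ℝ) : Prop where
  hΦ : ∀ t, HasDerivAt Φ (A t * Φ t) t
  hΨ : ∀ t, HasDerivAt Ψ ((A t + B t) * Ψ t) t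
  h1 : ∀ t, Φ t * Φi t = 1
  h2 : ∀ t, Φi t * Φ t = 1
  hB : ContinuousOn B (Ici 0)
  hP : P * P = P
  hK : 1 ≤ K
  hα : 0 < α
  hδ : 0 ≤ δ
  hsmall : 4 * K ^ 2 * δ < α
  e1 : ∀ s t : ℝ, 0 ≤ s → s ≤ t → ‖Φ t * P * Φi s‖ ≤ K * exp (-α * (t - s))
  e2 : ∀ t s : ℝ, 0 ≤ t → t ≤ s → ‖Φ t * (1 - P) * Φi s‖ ≤ K * exp (-α * (s - t))
  hBδ : ∀ t, 0 ≤ t → ‖B t‖ ≤ δ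

theorem cop_repr {R : Type*} [NormedRing R] [NormedAlgebra ℝ R] [CompleteSpace R]
    {A B Φ Φi Ψ : ℝ → R} {P : R} {K α δ : ℝ} (H : CopData A B Φ Φi Ψ P K α δ)
    (C : R) (a t b : ℝ) (ha : 0 ≤ a) (hat : a ≤ t) (htb : t ≤ b) :
    Ψ t * C = Φ t * P * Φi a * (Ψ a * C) + Φ t * (1 - P) * Φi b * (Ψ b * C)
      + (∫ u in a..t, Φ t * P * Φi u * (B u * (Ψ u * C)))
      - ∫ u in t..b, Φ t * (1 - P) * Φi u * (B u * (Ψ u * C)) := by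
  rw [cop_var A B Φ Φi Ψ H.hΦ H.hΨ H.h1 H.h2 H.hB _ C a t ha hat,
    cop_var A B Φ Φi Ψ H.hΦ H.hΨ H.h1 H.h2 H.hB _ C t b (ha.trans hat) htb]
  have : Φ t * P * Φi t * (Ψ t * C) + Φ t * (1 - P) * Φi t * (Ψ t * C) = Ψ t * C := by
    rw [← add_mul, ← add_mul, ← mul_add, add_sub_cancel, mul_one, H.h1, one_mul]
  refine this.symm.trans ?_
  abel

/-- Bound of the two integral terms under an exponential weight. -/
theorem cop_bound {R : Type*} [NormedRing R] [NormedAlgebra ℝ R]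
    {A B Φ Φi Ψ : ℝ → R} {P : R} {K α δ : ℝ} (H : CopData A B Φ Φi Ψ P K α δ)
    (C : R) (a t b s β S : ℝ) (ha : 0 ≤ a) (hat : a ≤ t) (htb : t ≤ b)
    (hβ : 0 ≤ β) (hβα : β < α) (hS : 0 ≤ S)
    (hY : ∀ u ∈ Icc a b, ‖Ψ u * C‖ ≤ S * exp (-β * |u - s|)) :
    ‖∫ u in a..t, Φ t * P * Φi u * (B u * (Ψ u * C))‖
        ≤ K * δ * S * exp (-β * |t - s|) / (α - β) ∧
    ‖∫ u in t..b, Φ t * (1 - P) * Φi u * (B u * (Ψ u * C))‖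
        ≤ K * δ * S * exp (-β * |t - s|) / (α - β) := by
  have hK := H.hK
  have hδ := H.hδ
  have hK0 : 0 ≤ K := by linarith
  have key : ∀ (G : R) (u : ℝ), u ∈ Icc a b → ‖G‖ ≤ K * exp (-α * |t - u|) →
      ‖G * (B u * (Ψ u * C))‖
        ≤ K * δ * S * exp (-β * |t - s|) * exp (-(α - β) * |t - u|) := by
    intro G u hu hG
    have hB := H.hBδ u (ha.trans hu.1)
    have hw : exp (-β * |u - s|) ≤ exp (-β * |t - s|) * exp (β * |t - u|) := by
      rw [← exp_add]
      apply exp_le_exp.2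
      have : |t - s| ≤ |t - u| + |u - s| := abs_sub_le t u s
      nlinarith
    calc ‖G * (B u * (Ψ u * C))‖ ≤ ‖G‖ * (‖B u‖ * ‖Ψ u * C‖) :=
          (norm_mul_le _ _).trans (by gcongr; exact norm_mul_le _ _)
      _ ≤ (K * exp (-α * |t - u|)) * (δ * (S * (exp (-β * |t - s|) * exp (β * |t - u|)))) := by
          gcongr
          exact (hY u hu).trans (by gcongr)
      _ = K * δ * S * exp (-β * |t - s|) * (exp (-α * |t - u|) * exp (β * |t - u|)) := by ring
      _ = _ := by rw [← exp_add]; ring_nf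
  constructor
  · apply cop_int_left _ _ _ _ (by linarith) hat (by positivity)
    intro u hu
    have habs : |t - u| = t - u := abs_of_nonneg (by linarith [hu.2])
    have := key _ u ⟨hu.1, hu.2.trans htb⟩ (by rw [habs]; exact H.e1 u t (ha.trans hu.1) hu.2)
    rwa [habs] at this
  · apply cop_int_right _ _ _ _ (by linarith) htb (by positivity)
    intro u hu
    have habs : |t - u| = u - t := by rw [abs_of_nonpos (by linarith [hu.1])]; ring
    have := key _ u ⟨hat.trans hu.1, hu.2⟩
      (by rw [habs]; exact H.e2 t u (ha.trans hat) hu.1)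
    rwa [habs] at this

/-- A priori exponential estimate for solutions. -/
theorem cop_apriori {R : Type*} [NormedRing R] [NormedAlgebra ℝ R] [CompleteSpace R]
    {A B Φ Φi Ψ : ℝ → R} {P : R} {K α δ : ℝ} (H : CopData A B Φ Φi Ψ P K α δ)
    (C : R) (a b s β c : ℝ) (ha : 0 ≤ a) (hab : a ≤ b)
    (hβ : 0 ≤ β) (hβα : β < α) (hγ : 4 * K * δ ≤ α - β)
    (hc : ∀ t ∈ Icc a b, ‖Φ t * P * Φi a * (Ψ a * C) + Φ t * (1 - P) * Φi b * (Ψ b * C)‖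
      ≤ c * exp (-β * |t - s|)) :
    ∀ t ∈ Icc a b, ‖Ψ t * C‖ ≤ 2 * c * exp (-β * |t - s|) := by
  have hΨc : Continuous Ψ := continuous_iff_continuousAt.2 fun t => (H.hΨ t).continuousAt
  have hgc : Continuous fun t => exp (β * |t - s|) * ‖Ψ t * C‖ := by fun_prop
  obtain ⟨τ, hτ, hmax⟩ := isCompact_Icc.exists_isMaxOn (nonempty_Icc.2 hab) hgc.continuousOn
  set S := exp (β * |τ - s|) * ‖Ψ τ * C‖ with hSdef
  have hS : 0 ≤ S := by positivity
  have hY : ∀ u ∈ Icc a b, ‖Ψ u * C‖ ≤ S * exp (-β * |u - s|) := by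
    intro u hu
    have h : exp (β * |u - s|) * ‖Ψ u * C‖ ≤ S := hmax hu
    rw [neg_mul, exp_neg, ← div_eq_mul_inv, le_div_iff₀ (exp_pos _)]
    linarith
  obtain ⟨b1, b2⟩ := cop_bound H C a τ b s β S ha hτ.1 hτ.2 hβ hβα hS hY
  have hr := cop_repr H C a τ b ha hτ.1 hτ.2
  have hcτ := hc τ hτ
  have hn : ‖Ψ τ * C‖ ≤ c * exp (-β * |τ - s|)
      + K * δ * S * exp (-β * |τ - s|) / (α - β) + K * δ * S * exp (-β * |τ - s|) / (α - β) := by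
    conv_lhs => rw [hr]
    refine (norm_sub_le _ _).trans (add_le_add ((norm_add_le _ _).trans ?_) b2)
    exact add_le_add hcτ b1
  have hq : K * δ * S / (α - β) ≤ S / 4 := by
    rw [div_le_iff₀ (by linarith)]
    nlinarith
  have hn2 : ‖Ψ τ * C‖ ≤ (c + S / 2) * exp (-β * |τ - s|) := by
    refine hn.trans ?_
    have : K * δ * S * exp (-β * |τ - s|) / (α - β)
      = K * δ * S / (α - β) * exp (-β * |τ - s|) := by ring
    rw [this]
    have h4 := mul_le_mul_of_nonneg_right hq (exp_pos (-β * |τ - s|)).le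
    linarith
  have hS2 : S ≤ c + S / 2 := by
    rw [neg_mul, exp_neg, ← div_eq_mul_inv, le_div_iff₀ (exp_pos _)] at hn2
    linarith
  intro t ht
  refine (hY t ht).trans ?_
  gcongr
  linarith

theorem cop_finite {R : Type*} [NormedRing R] [NormedAlgebra ℝ R] [FiniteDimensional ℝ R]
    {A B Φ Φi Ψ : ℝ → R} {P : R} {K α δ : ℝ} (H : CopData A B Φ Φi Ψ P K α δ)
    (Ψi : ℝ → R) (hΦi0 : Φi 0 = 1) (hΦ0 : Φ 0 = 1) (hΨ0 : Ψ 0 = 1)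
    (g1 : ∀ t, Ψ t * Ψi t = 1)
    (β η D : ℝ) (hβ : 0 ≤ β) (hβα : β < α) (hγ : 4 * K * δ ≤ α - β)
    (hη : η = 2 * K ^ 2 * δ / α) (hD : D = 2 * K * η / (1 - 2 * η))
    (T : ℝ) (hT : 0 ≤ T) :
    ∃ Q : R, P * Q = P ∧ Q * P = Q ∧
      (∀ s t : ℝ, 0 ≤ s → s ≤ t → t ≤ T →
        ‖Ψ t * Q * Ψi s‖ ≤ 2 * K * (K + D) * exp (-β * (t - s))) ∧
      (∀ t s : ℝ, 0 ≤ t → t ≤ s → s ≤ T →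
        ‖Ψ t * (1 - Q) * Ψi s‖ ≤ 2 * K * (K + D) * exp (-β * (s - t))) := by
  haveI : CompleteSpace R := FiniteDimensional.complete ℝ R
  have hK := H.hK
  have hK0 : 0 ≤ K := by linarith
  have hδ := H.hδ
  have hα := H.hα
  have hP := H.hP
  -- the linear map is injective, hence surjective
  let M : R := P + (1 - P) * Φi T * Ψ T
  have hPM : ∀ C, P * (M * C) = P * C := by
    intro C
    have : P * (1 - P) = 0 := by rw [mul_sub, mul_one, hP, sub_self]
    calc P * (M * C) = P * P * C + P * (1 - P) * (Φi T * Ψ T * C) := by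
          simp only [M]; noncomm_ring
      _ = P * C := by rw [this, hP, zero_mul, add_zero]
  have hPM2 : ∀ C, (1 - P) * (M * C) = (1 - P) * Φi T * (Ψ T * C) := by
    intro C
    have h1 : (1 - P) * P = 0 := by rw [sub_mul, one_mul, hP, sub_self]
    have h2 : (1 - P) * (1 - P) = (1 - P) := by rw [mul_sub, h1, mul_one, sub_zero]
    calc (1 - P) * (M * C) = (1 - P) * P * C + (1 - P) * (1 - P) * (Φi T * Ψ T * C) := by
          simp only [M]; noncomm_ring
      _ = (1 - P) * Φi T * (Ψ T * C) := by rw [h1, h2, zero_mul, zero_add]; noncomm_ring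
  have hinj : Function.Injective (LinearMap.mulLeft ℝ M) := by
    rw [← LinearMap.ker_eq_bot, LinearMap.ker_eq_bot']
    intro C hC
    rw [LinearMap.mulLeft_apply] at hC
    have k1 := hPM C
    have k2 := hPM2 C
    rw [hC, mul_zero] at k1 k2
    have := cop_apriori H C 0 T 0 β 0 le_rfl hT hβ hβα hγ (by
      intro t _
      have e1 : Φ t * P * Φi 0 * (Ψ 0 * C) = Φ t * (P * C) := by
        rw [hΦi0, hΨ0]; noncomm_ring
      have e2 : Φ t * (1 - P) * Φi T * (Ψ T * C) = Φ t * ((1 - P) * Φi T * (Ψ T * C)) := by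
        noncomm_ring
      rw [e1, e2, ← k1, ← k2]
      simp) 0 ⟨le_rfl, hT⟩
    rw [hΨ0, one_mul] at this
    simpa using this
  have hsurj := LinearMap.injective_iff_surjective.1 hinj
  obtain ⟨N, hN⟩ := hsurj P
  rw [LinearMap.mulLeft_apply] at hN
  let Q := N * P
  have hMQ : M * Q = P := by rw [← mul_assoc, hN, hP]
  have hPQ : P * Q = P := by rw [← hPM Q, hMQ, hP]
  have hQP : Q * P = Q := by rw [mul_assoc, hP]
  have hTQ : (1 - P) * Φi T * (Ψ T * Q) = 0 := by
    rw [← hPM2 Q, hMQ, sub_mul, one_mul, hP, sub_self]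
  have hP1Q : P * (1 - Q) = 0 := by rw [mul_sub, mul_one, hPQ, sub_self]
  -- first family of terms vanish
  have z1 : ∀ t Z, Φ t * (1 - P) * Φi T * (Ψ T * (Q * Z)) = 0 := by
    intro t Z
    calc _ = Φ t * ((1 - P) * Φi T * (Ψ T * Q)) * Z := by noncomm_ring
      _ = 0 := by rw [hTQ]; simp
  have z2 : ∀ t Z, Φ t * P * Φi 0 * (Ψ 0 * ((1 - Q) * Z)) = 0 := by
    intro t Z
    calc _ = Φ t * (P * (1 - Q)) * Z := by rw [hΦi0, hΨ0]; noncomm_ring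
      _ = 0 := by rw [hP1Q]; simp
  -- estimates relative to the initial value
  have est1 : ∀ Z s, 0 ≤ s → s ≤ T → ∀ t ∈ Icc s T,
      ‖Ψ t * (Q * Z)‖ ≤ 2 * (K * ‖Ψ s * (Q * Z)‖) * exp (-β * |t - s|) := by
    intro Z s hs hsT
    apply cop_apriori H (Q * Z) s T s β _ hs hsT hβ hβα hγ
    intro t ht
    rw [z1, add_zero, abs_of_nonneg (by linarith [ht.1])]
    have hts : 0 ≤ t - s := by linarith [ht.1]
    calc _ ≤ ‖Φ t * P * Φi s‖ * ‖Ψ s * (Q * Z)‖ := norm_mul_le _ _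
      _ ≤ K * exp (-β * (t - s)) * ‖Ψ s * (Q * Z)‖ := by
          gcongr
          refine (H.e1 s t hs ht.1).trans ?_
          gcongr
      _ = _ := by ring
  have est2 : ∀ Z s, 0 ≤ s → ∀ t ∈ Icc 0 s,
      ‖Ψ t * ((1 - Q) * Z)‖ ≤ 2 * (K * ‖Ψ s * ((1 - Q) * Z)‖) * exp (-β * |t - s|) := by
    intro Z s hs
    apply cop_apriori H ((1 - Q) * Z) 0 s s β _ le_rfl hs hβ hβα hγ
    intro t ht
    have hts : 0 ≤ s - t := by linarith [ht.2]
    rw [z2, zero_add, abs_sub_comm, abs_of_nonneg hts]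
    calc _ ≤ ‖Φ t * (1 - P) * Φi s‖ * ‖Ψ s * ((1 - Q) * Z)‖ := norm_mul_le _ _
      _ ≤ K * exp (-β * (s - t)) * ‖Ψ s * ((1 - Q) * Z)‖ := by
          gcongr
          refine (H.e2 t s ht.1 ht.2).trans ?_
          gcongr
      _ = _ := by ring
  have hη0 : 0 ≤ η := by rw [hη]; positivity
  have hη2 : 2 * η < 1 := by
    have h4 := H.hsmall
    rw [hη, ← mul_div_assoc, div_lt_one hα]; linarith
  -- bound of the projections
  have hproj : ∀ s, 0 ≤ s → s ≤ T →
      ‖Ψ s * (Q * Ψi s)‖ ≤ K + D ∧ ‖Ψ s * ((1 - Q) * Ψi s)‖ ≤ K + D := by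
    intro s hs hsT
    set q := ‖Ψ s * (Q * Ψi s)‖ with hq
    set r := ‖Ψ s * ((1 - Q) * Ψi s)‖ with hr
    have hq0 : 0 ≤ q := norm_nonneg _
    have hr0 : 0 ≤ r := norm_nonneg _
    have i1 : ‖∫ u in s..T, Φ s * (1 - P) * Φi u * (B u * (Ψ u * (Q * Ψi s)))‖ ≤ η * q := by
      refine (cop_bound H (Q * Ψi s) s s T s 0 (2 * (K * q)) hs le_rfl hsT le_rfl hα
        (by positivity) ?_).2.trans (le_of_eq ?_)
      · intro u hu
        refine (est1 (Ψi s) s hs hsT u hu).trans ?_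
        apply mul_le_mul_of_nonneg_left _ (by positivity)
        apply exp_le_exp.2
        have := abs_nonneg (u - s)
        nlinarith
      · rw [hη]; simp; ring
    have i2 : ‖∫ u in (0:ℝ)..s, Φ s * P * Φi u * (B u * (Ψ u * ((1 - Q) * Ψi s)))‖ ≤ η * r := by
      refine (cop_bound H ((1 - Q) * Ψi s) 0 s s s 0 (2 * (K * r)) le_rfl hs le_rfl le_rfl hα
        (by positivity) ?_).1.trans (le_of_eq ?_)
      · intro u hu
        refine (est2 (Ψi s) s hs u hu).trans ?_
        apply mul_le_mul_of_nonneg_left _ (by positivity)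
        apply exp_le_exp.2
        have := abs_nonneg (u - s)
        nlinarith
      · rw [hη]; simp; ring
    have r1 := cop_repr H (Q * Ψi s) s s T hs le_rfl hsT
    have r2 := cop_repr H ((1 - Q) * Ψi s) 0 s s le_rfl hs le_rfl
    rw [z1, intervalIntegral.integral_same, add_zero, add_zero] at r1
    rw [z2, intervalIntegral.integral_same, zero_add, sub_zero] at r2
    set I1 := ∫ u in s..T, Φ s * (1 - P) * Φi u * (B u * (Ψ u * (Q * Ψi s)))
    set I2 := ∫ u in (0:ℝ)..s, Φ s * P * Φi u * (B u * (Ψ u * ((1 - Q) * Ψi s)))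
    have hsum : Ψ s * (Q * Ψi s) + Ψ s * ((1 - Q) * Ψi s) = 1 := by
      rw [← mul_add, ← add_mul, add_sub_cancel, one_mul, g1]
    have hpp : Φ s * P * Φi s + Φ s * (1 - P) * Φi s = 1 := by
      rw [← add_mul, ← mul_add, add_sub_cancel, mul_one, H.h1]
    set X := Ψ s * (Q * Ψi s)
    set W := Ψ s * ((1 - Q) * Ψi s)
    set p := Φ s * P * Φi s
    set p' := Φ s * (1 - P) * Φi s
    have hW : W = 1 - X := eq_sub_of_add_eq' hsum
    have hp' : p' = 1 - p := eq_sub_of_add_eq' hpp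
    have hpW : p * W = I2 := by
      have : p * W = W - p' * W := by rw [hp']; noncomm_ring
      rw [this]
      exact sub_eq_of_eq_add' r2
    have hpX : p' * X = - I1 := by
      have : p' * X = X - p * X := by rw [hp']; noncomm_ring
      rw [this, sub_eq_iff_eq_add']
      rw [← sub_eq_add_neg]; exact r1
    have hXp : X - p = - I1 - I2 := by
      rw [← hpX, ← hpW, hp', hW]; noncomm_ring
    have hWp : W - p' = I1 + I2 := by
      have : W - p' = - (X - p) := by rw [hp', hW]; abel
      rw [this, hXp]; abel
    have hd1 : ‖X - p‖ ≤ η * q + η * r := by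
      rw [hXp]
      refine (norm_sub_le _ _).trans ?_
      rw [norm_neg]; exact add_le_add i1 i2
    have hd2 : ‖W - p'‖ ≤ η * q + η * r := by
      rw [hWp]
      exact (norm_add_le _ _).trans (add_le_add i1 i2)
    have hpK : ‖p‖ ≤ K := by simpa using H.e1 s s hs le_rfl
    have hpK' : ‖p'‖ ≤ K := by simpa using H.e2 s s hs le_rfl
    have hqb : q ≤ K + (η * q + η * r) := by
      have : X = p + (X - p) := by abel
      calc q = ‖p + (X - p)‖ := by rw [← this]
        _ ≤ _ := (norm_add_le _ _).trans (add_le_add hpK hd1)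
    have hrb : r ≤ K + (η * q + η * r) := by
      have : W = p' + (W - p') := by abel
      calc r = ‖p' + (W - p')‖ := by rw [← this]
        _ ≤ _ := (norm_add_le _ _).trans (add_le_add hpK' hd2)
    have hdD : η * q + η * r ≤ D := by
      rw [hD, le_div_iff₀ (by linarith)]
      nlinarith
    exact ⟨by linarith, by linarith⟩
  refine ⟨Q, hPQ, hQP, ?_, ?_⟩
  · intro s t hs hst htT
    have h := est1 (Ψi s) s hs (hst.trans htT) t ⟨hst, htT⟩
    rw [abs_of_nonneg (by linarith), ← mul_assoc] at h
    refine h.trans ?_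
    have := (hproj s hs (hst.trans htT)).1
    rw [mul_assoc 2 K (K + D)]
    gcongr
  · intro t s ht hts hsT
    have h := est2 (Ψi s) s (ht.trans hts) t ⟨ht, hts⟩
    rw [abs_sub_comm, abs_of_nonneg (by linarith), ← mul_assoc] at h
    refine h.trans ?_
    have := (hproj s (ht.trans hts) hsT).2
    rw [mul_assoc 2 K (K + D)]
    gcongr

theorem cop_main {R : Type*} [NormedRing R] [NormedAlgebra ℝ R] [FiniteDimensional ℝ R]
    {A B Φ Φi Ψ : ℝ → R} {P : R} {K α δ : ℝ} (H : CopData A B Φ Φi Ψ P K α δ)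
    (Ψi : ℝ → R) (hΦi0 : Φi 0 = 1) (hΦ0 : Φ 0 = 1) (hΨ0 : Ψ 0 = 1) (hΨi0 : Ψi 0 = 1)
    (g1 : ∀ t, Ψ t * Ψi t = 1) :
    ∃ Q : R, P * Q = P ∧ Q * P = Q ∧ ∃ K' ≥ (1:ℝ), ∃ α' > (0:ℝ),
      (∀ s t : ℝ, 0 ≤ s → s ≤ t → ‖Ψ t * Q * Ψi s‖ ≤ K' * exp (-α' * (t - s))) ∧
      (∀ t s : ℝ, 0 ≤ t → t ≤ s → ‖Ψ t * (1 - Q) * Ψi s‖ ≤ K' * exp (-α' * (s - t))) := by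
  have hK := H.hK
  have hδ := H.hδ
  have hα := H.hα
  have hs := H.hsmall
  have hKδ : 4 * K * δ < α := by nlinarith [mul_nonneg (by nlinarith : 0 ≤ K * (K - 1)) hδ]
  haveI : ProperSpace R := FiniteDimensional.proper_real R
  obtain ⟨β, hβ0, hβα, hβγ⟩ : ∃ β : ℝ, 0 < β ∧ β < α ∧ 4 * K * δ ≤ α - β := by
    have h0 : 0 ≤ 4 * K * δ := by positivity
    exact ⟨(α - 4 * K * δ) / 2, by linarith, by linarith, by linarith⟩
  obtain ⟨η, hη⟩ : ∃ η, η = 2 * K ^ 2 * δ / α := ⟨_, rfl⟩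
  obtain ⟨D, hD⟩ : ∃ D, D = 2 * K * η / (1 - 2 * η) := ⟨_, rfl⟩
  have hη0 : 0 ≤ η := by rw [hη]; positivity
  have hη2 : 2 * η < 1 := by
    rw [hη, ← mul_div_assoc, div_lt_one hα]; linarith
  have hD0 : 0 ≤ D := by
    rw [hD]; exact div_nonneg (by positivity) (by linarith)
  choose q hPq hqP hq1 hq2 using fun N : ℕ =>
    cop_finite H Ψi hΦi0 hΦ0 hΨ0 g1 β η D hβ0.le hβα hβγ hη hD (N : ℝ) N.cast_nonneg
  have hbd : ∀ N, q N ∈ Metric.closedBall (0 : R) (2 * K * (K + D)) := by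
    intro N
    have := hq1 N 0 0 le_rfl le_rfl N.cast_nonneg
    rw [hΨ0, hΨi0] at this
    simpa using this
  obtain ⟨Q, -, σ, hσ, hlim⟩ :=
    tendsto_subseq_of_bounded Metric.isBounded_closedBall hbd
  have hev : ∀ t : ℝ, ∀ᶠ k in Filter.atTop, t ≤ ((σ k : ℕ) : ℝ) := fun t =>
    (tendsto_natCast_atTop_atTop.comp hσ.tendsto_atTop).eventually_ge_atTop t
  refine ⟨Q, ?_, ?_, 2 * K * (K + D), ?_, β, hβ0, ?_, ?_⟩
  · refine tendsto_nhds_unique (hlim.const_mul P) ?_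
    simp only [Function.comp_apply, hPq]
    exact tendsto_const_nhds
  · refine tendsto_nhds_unique (hlim.mul_const P) ?_
    simp only [Function.comp_apply, hqP]
    exact hlim
  · nlinarith
  · intro s t hs hst
    refine le_of_tendsto (((hlim.const_mul (Ψ t)).mul_const (Ψi s)).norm) ?_
    filter_upwards [hev t] with k hk
    exact hq1 _ s t hs hst hk
  · intro t s ht hts
    refine le_of_tendsto ((((hlim.const_sub 1).const_mul (Ψ t)).mul_const (Ψi s)).norm) ?_
    filter_upwards [hev s] with k hk
    exact hq2 _ t s ht hts hk

/-- Roughness of exponential dichotomy (Coppel): if `ẋ = A(t)x` has an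
exponential dichotomy on `[0,∞)` with projection `P` and constants `K ≥ 1`,
`α > 0`, and `sup_{t≥0} ‖B(t)‖ < α/(4K²)`, then `ẋ = (A(t)+B(t))x` has an
exponential dichotomy on `[0,∞)` with a projection `Q` having the same null
space as `P`. -/
theorem roughness_exponential_dichotomy_coppel
    (n : ℕ)
    (A : ℝ → Matrix (Fin n) (Fin n) ℝ)
    (hA_cont : ContinuousOn A (Ici 0))
    (Φ : ℝ → Matrix (Fin n) (Fin n) ℝ)
    (hΦ_deriv : ∀ t : ℝ, HasDerivAt Φ (A t * Φ t) t)
    (hΦ0 : Φ 0 = 1)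
    (hΦ_inv : ∀ t : ℝ, IsUnit (Φ t))
    (P : Matrix (Fin n) (Fin n) ℝ) (hP : P * P = P)
    (K α : ℝ) (hK : 1 ≤ K) (hα : 0 < α)
    (hED₁ : ∀ s t : ℝ, 0 ≤ s → s ≤ t → ‖Φ t * P * (Φ s)⁻¹‖ ≤ K * exp (-α * (t - s)))
    (hED₂ : ∀ t s : ℝ, 0 ≤ t → t ≤ s → ‖Φ t * (1 - P) * (Φ s)⁻¹‖ ≤ K * exp (-α * (s - t)))
    (B : ℝ → Matrix (Fin n) (Fin n) ℝ)
    (hB_cont : ContinuousOn B (Ici 0))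
    (hB_small : ∃ c : ℝ, c < α / (4 * K ^ 2) ∧ ∀ t ≥ (0:ℝ), ‖B t‖ ≤ c) :
    ∀ Ψ : ℝ → Matrix (Fin n) (Fin n) ℝ,
      (∀ t : ℝ, HasDerivAt Ψ ((A t + B t) * Ψ t) t) → Ψ 0 = 1 →
      (∀ t : ℝ, IsUnit (Ψ t)) →
      ∃ Q : Matrix (Fin n) (Fin n) ℝ, Q * Q = Q ∧
        LinearMap.ker (Matrix.toLin' Q) = LinearMap.ker (Matrix.toLin' P) ∧
        ∃ K' ≥ (1:ℝ), ∃ α' > (0:ℝ),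
          (∀ s t : ℝ, 0 ≤ s → s ≤ t →
            ‖Ψ t * Q * (Ψ s)⁻¹‖ ≤ K' * exp (-α' * (t - s))) ∧
          (∀ t s : ℝ, 0 ≤ t → t ≤ s →
            ‖Ψ t * (1 - Q) * (Ψ s)⁻¹‖ ≤ K' * exp (-α' * (s - t))) := by
  intro Ψ hΨ hΨ0 hΨ_inv
  obtain ⟨c, hc, hBc⟩ := hB_small
  letI : NormedAlgebra ℝ (Matrix (Fin n) (Fin n) ℝ) := Matrix.linftyOpNormedAlgebra
  have hdet : ∀ {M : Matrix (Fin n) (Fin n) ℝ}, IsUnit M → IsUnit M.det := fun h =>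
    (Matrix.isUnit_iff_isUnit_det _).1 h
  have H : CopData A B Φ (fun t => (Φ t)⁻¹) Ψ P K α c :=
    { hΦ := hΦ_deriv
      hΨ := hΨ
      h1 := fun t => Matrix.mul_nonsing_inv _ (hdet (hΦ_inv t))
      h2 := fun t => Matrix.nonsing_inv_mul _ (hdet (hΦ_inv t))
      hB := hB_cont
      hP := hP
      hK := hK
      hα := hα
      hδ := (norm_nonneg _).trans (hBc 0 le_rfl)
      hsmall := by
        rw [lt_div_iff₀ (by positivity)] at hc
        linarith
      e1 := hED₁
      e2 := hED₂
      hBδ := hBc }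
  obtain ⟨Q, hPQ, hQP, K', hK', α', hα', h1, h2⟩ :=
    cop_main H (fun t => (Ψ t)⁻¹) (by simp [hΦ0]) hΦ0 hΨ0 (by simp [hΨ0])
      (fun t => Matrix.mul_nonsing_inv _ (hdet (hΨ_inv t)))
  refine ⟨Q, ?_, ?_, K', hK', α', hα', h1, h2⟩
  · calc Q * Q = Q * P * Q := by rw [hQP]
      _ = Q := by rw [mul_assoc, hPQ, hQP]
  · ext v
    simp only [LinearMap.mem_ker, Matrix.toLin'_apply]
    constructor
    · intro h
      rw [← hPQ, ← Matrix.mulVec_mulVec, h, Matrix.mulVec_zero]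
    · intro h
      rw [← hQP, ← Matrix.mulVec_mulVec, h, Matrix.mulVec_zero]
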